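/- Assume the standing hypotheses hold (for all n >= N: s_{n,i} in {0,d}, s_{n,r_n} = 0, s_{n,i} not constant over 0 <= i < r_n, where d >= 1). For n >= N write B_{n+1} = (prod_{j=1}^{z_n - 1} B_n^{a_{n,j}} 1^d) B_n^{a_{n,z_n}} with all a_{n,j} >= 1. If a_{n,1} > 2, or a_{n,j} > 3 for some j, then the word B_n B_n B_n is right-special. -/

import Mathlib

/-- The rank-one word sequence: `B 1 = 0` and `B (n+1) = ∏_{i=0}^{r n} B n 1^{s n i}`
over the alphabet `{0,1}` (encoded as `Bool` with `false = 0`, `true = 1`).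
The value at `0` is an irrelevant placeholder. -/
def Bseq (r : ℕ → ℕ) (s : ℕ → ℕ → ℕ) : ℕ → List Bool
  | 0 => [false]
  | 1 => [false]
  | n + 2 =>
      ((List.range (r (n + 1) + 1)).map
        (fun i => Bseq r s (n + 1) ++ List.replicate (s (n + 1) i) true)).flatten

/-- The language of the rank-one subshift: all factors of some `B n`. -/
def InLang (r : ℕ → ℕ) (s : ℕ → ℕ → ℕ) (w : List Bool) : Prop :=
  ∃ n, w <:+: Bseq r s n

/-- A word `w` is right-special if both `w0` and `w1` belong to the language. -/
def RightSpecial (r : ℕ → ℕ) (s : ℕ → ℕ → ℕ) (w : List Bool) : Prop :=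
  InLang r s (w ++ [false]) ∧ InLang r s (w ++ [true])

/-- `w ^ k` : the `k`-fold concatenation of the word `w`. -/
def wpow (w : List Bool) (k : ℕ) : List Bool := (List.replicate k w).flatten

theorem Bseq_succ (r : ℕ → ℕ) (s : ℕ → ℕ → ℕ) {n : ℕ} (hn : 1 ≤ n) :
    Bseq r s (n + 1) = ((List.range (r n + 1)).map
      (fun i => Bseq r s n ++ List.replicate (s n i) true)).flatten := by
  obtain ⟨m, rfl⟩ := Nat.exists_eq_add_of_le' hn
  rfl

theorem append_infix_flatten_map_range {α : Type*} (f : ℕ → List α) {i m : ℕ} (h : i + 1 < m) :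
    f i ++ f (i + 1) <:+: ((List.range m).map f).flatten := by
  obtain ⟨k, rfl⟩ := Nat.exists_eq_add_of_le (show i + 2 ≤ m from h)
  refine ⟨((List.range i).map f).flatten, ((List.range k).map fun x => f (i + 2 + x)).flatten, ?_⟩
  simp [List.range_add, List.range_succ, Function.comp_def]

theorem infix_flatten_map_range {α : Type*} (f : ℕ → List α) {i m : ℕ} (h : i < m) :
    f i <:+: ((List.range m).map f).flatten :=
  List.infix_of_mem_flatten (List.mem_map_of_mem (List.mem_range.2 h))

theorem Bseq_eq_false_cons (r : ℕ → ℕ) (s : ℕ → ℕ → ℕ) (n : ℕ) :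
    ∃ t, Bseq r s n = false :: t := by
  induction n with
  | zero => exact ⟨[], rfl⟩
  | succ n ih =>
    rcases Nat.eq_zero_or_pos n with rfl | hn
    · exact ⟨[], rfl⟩
    · obtain ⟨t, ht⟩ := ih
      rw [Bseq_succ r s hn, List.range_succ_eq_map, List.map_cons, List.flatten_cons, ht]
      exact ⟨_, rfl⟩

theorem wpow_add (w : List Bool) (j k : ℕ) : wpow w (j + k) = wpow w j ++ wpow w k := by
  rw [wpow, ← List.replicate_append_replicate, List.flatten_append, wpow, wpow]

theorem wpow_one (w : List Bool) : wpow w 1 = w := by simp [wpow]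

theorem wpow_three (w : List Bool) : wpow w 3 = w ++ w ++ w := by
  simp [wpow, List.replicate_succ]

theorem wpow_infix_of_le (w : List Bool) {j k : ℕ} (h : j ≤ k) : wpow w j <:+: wpow w k := by
  obtain ⟨m, rfl⟩ := Nat.exists_eq_add_of_le h
  exact ⟨[], wpow w m, by simp [wpow_add]⟩

theorem cube_true_infix (w : List Bool) {k d : ℕ} (hk : 3 ≤ k) (hd : 1 ≤ d) :
    w ++ w ++ w ++ [true] <:+: wpow w k ++ List.replicate d true := by
  obtain ⟨m, rfl⟩ := Nat.exists_eq_add_of_le' hk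
  obtain ⟨e, rfl⟩ := Nat.exists_eq_add_of_le' hd
  exact ⟨wpow w m, List.replicate e true, by simp [wpow_add, wpow_three, List.replicate_succ]⟩

theorem cube_false_infix {w t : List Bool} (hw : w = false :: t) {k : ℕ} (hk : 4 ≤ k) :
    w ++ w ++ w ++ [false] <:+: wpow w k := by
  refine List.IsInfix.trans ⟨[], t, ?_⟩ (wpow_infix_of_le w hk)
  rw [show 4 = 3 + 1 from rfl, wpow_add, wpow_one, wpow_three]
  simp [hw]

/-- Under the standing spacer hypotheses, writing
`B_{n+1} = (∏_{j=1}^{z_n-1} B_n^{a_{n,j}} 1^d) B_n^{a_{n,z_n}}` with all `a_{n,j} ≥ 1`,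
if `a_{n,1} > 2` or `a_{n,j} > 3` for some `j`, then `B_n B_n B_n` is right-special. -/
theorem stmt10 (r : ℕ → ℕ) (s : ℕ → ℕ → ℕ) (hr : ∀ n, 1 ≤ r n)
    (d : ℕ) (hd : 1 ≤ d) (N : ℕ) (hN : 1 ≤ N)
    (hyp : ∀ n, N ≤ n →
      (∀ i, i < r n → s n i = 0 ∨ s n i = d) ∧
      s n (r n) = 0 ∧
      (∃ i, i < r n ∧ s n i = 0) ∧ (∃ i, i < r n ∧ s n i = d))
    (n : ℕ) (hn : N ≤ n) (z : ℕ) (hz : 2 ≤ z) (a : ℕ → ℕ)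
    (ha : ∀ j, 1 ≤ j → j ≤ z → 1 ≤ a j)
    (ha2 : ∃ j, 1 ≤ j ∧ j ≤ z ∧ 2 ≤ a j)
    (hrep : Bseq r s (n + 1) =
      ((List.range (z - 1)).map
        (fun j => wpow (Bseq r s n) (a (j + 1)) ++ List.replicate d true)).flatten ++
        wpow (Bseq r s n) (a z))
    (h1 : 2 < a 1 ∨ ∃ j, 1 ≤ j ∧ j ≤ z ∧ 3 < a j) :
    RightSpecial r s (Bseq r s n ++ Bseq r s n ++ Bseq r s n) := by
  obtain ⟨t, ht⟩ := Bseq_eq_false_cons r s n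
  obtain ⟨-, -, ⟨i₀, hi₀, hs₀⟩, i₁, hi₁, hs₁⟩ := hyp (n + 1) (by omega)
  have square : Bseq r s (n + 1) ++ Bseq r s (n + 1) <:+: Bseq r s (n + 1 + 1) := by
    rw [Bseq_succ r s (show 1 ≤ n + 1 by omega)]
    refine List.IsInfix.trans ⟨[], List.replicate (s (n + 1) (i₀ + 1)) true, ?_⟩
      (append_infix_flatten_map_range _ (show i₀ + 1 < r (n + 1) + 1 by omega))
    simp [hs₀]
  have spaced : Bseq r s (n + 1) ++ List.replicate d true <:+: Bseq r s (n + 1 + 1) := by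
    rw [Bseq_succ r s (show 1 ≤ n + 1 by omega), ← hs₁]
    exact infix_flatten_map_range
      (fun i => Bseq r s (n + 1) ++ List.replicate (s (n + 1) i) true)
      (show i₁ < r (n + 1) + 1 by omega)
  have block : ∀ j, j < z - 1 →
      wpow (Bseq r s n) (a (j + 1)) ++ List.replicate d true <:+: Bseq r s (n + 1) := by
    intro j hj
    rw [hrep]
    exact (infix_flatten_map_range
      (fun j => wpow (Bseq r s n) (a (j + 1)) ++ List.replicate d true) hj).trans
      (List.prefix_append _ _).isInfix
  have last : wpow (Bseq r s n) (a z) <:+ Bseq r s (n + 1) := by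
    rw [hrep]
    exact List.suffix_append _ _
  rcases h1 with h1 | ⟨j, hj1, hjz, hj⟩
  · refine ⟨⟨n + 1 + 1, ?_⟩, ⟨n + 1, (cube_true_infix _ h1 hd).trans (block 0 (by omega))⟩⟩
    have first : wpow (Bseq r s n) (a 1) <+: Bseq r s (n + 1) := by
      obtain ⟨k, hk⟩ : ∃ k, z - 1 = k + 1 := ⟨z - 2, by omega⟩
      rw [hrep, hk, List.range_succ_eq_map]
      simp
    have haz := ha z (by omega) le_rfl
    refine (cube_false_infix ht (show 4 ≤ a z + a 1 by omega)).trans (.trans ?_ square)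
    obtain ⟨p, hp⟩ := last
    obtain ⟨q, hq⟩ := first
    refine ⟨p, q, ?_⟩
    calc p ++ wpow (Bseq r s n) (a z + a 1) ++ q
        = (p ++ wpow (Bseq r s n) (a z)) ++ (wpow (Bseq r s n) (a 1) ++ q) := by
          simp [wpow_add]
      _ = _ := by rw [hp, hq]
  · rcases hjz.lt_or_eq with hlt | rfl
    · have hb := block (j - 1) (by omega)
      rw [Nat.sub_add_cancel hj1] at hb
      exact ⟨⟨n + 1, (cube_false_infix ht hj).trans ((List.prefix_append _ _).isInfix.trans hb)⟩,
        ⟨n + 1, (cube_true_infix _ hj.le hd).trans hb⟩⟩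
    · refine ⟨⟨n + 1, (cube_false_infix ht hj).trans last.isInfix⟩,
        ⟨n + 1 + 1, (cube_true_infix _ hj.le hd).trans (.trans ?_ spaced)⟩⟩
      obtain ⟨p, hp⟩ := last
      exact ⟨p, [], by rw [← hp]; simp⟩
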